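/- Let Π = (Ṽ, R) be the Boolean P system constructed from a deterministic LBA 𝓜 and an input of length n (with symbols A_{v,j} encoding tape contents and C_{q,j} encoding the head position and state, and rules R_ρ encoding the instructions of 𝓜). If a configuration W ⊆ Ṽ contains exactly one symbol of the form C_{q,j}, and for each cell index j' contains at most one symbol of the form A_{v,j'}, then at most one rule of R is applicable to W. -/

import Mathlib

/-- A rule `A → B | φ` of a Boolean P system: a left-hand side `A ⊆ V`,
a right-hand side `B ⊆ V`, and a guard `φ`, a predicate on subsets of `V`. -/
structure BRule (σ : Type*) where
  lhs : Set σ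
  rhs : Set σ
  guard : Set σ → Prop

/-- A rule `A → B | φ` is applicable to a configuration `W` iff `A ⊆ W` and `φ(W)` holds. -/
def BRule.applicable {σ : Type*} (r : BRule σ) (W : Set σ) : Prop :=
  r.lhs ⊆ W ∧ r.guard W

/-- `Appl R W` : the set of all subsets of the rule set `R` each of whose
rules is applicable to `W`. -/
def Appl {σ : Type*} (R : Set (BRule σ)) (W : Set σ) : Set (Set (BRule σ)) :=
  {m | m ⊆ R ∧ ∀ r ∈ m, r.applicable W}

/-- Applying a set of (individually applicable) rules `{Aᵢ → Bᵢ | φᵢ}` to `W`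
yields `(W \ ⋃ᵢ Aᵢ) ∪ ⋃ᵢ Bᵢ`. -/
def applyRules {σ : Type*} (m : Set (BRule σ)) (W : Set σ) : Set σ :=
  (W \ ⋃ r ∈ m, BRule.lhs r) ∪ ⋃ r ∈ m, BRule.rhs r

/-- Applying a set of rules to `W`, where exactly those rules of the set that
are applicable to `W` are applied. -/
def applyAppl {σ : Type*} (m : Set (BRule σ)) (W : Set σ) : Set σ :=
  applyRules {r ∈ m | r.applicable W} W

/-- `A ⊗ B = { a ∪ b | a ∈ A, b ∈ B }` for sets of sets. -/
def otimes {α : Type*} (A B : Set (Set α)) : Set (Set α) :=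
  {c | ∃ a ∈ A, ∃ b ∈ B, c = a ∪ b}

/-- One evolution step of a Boolean P system under a quasimode `Mt`: choose a
set of rules `m ∈ Mt` and apply all of its rules applicable to the current
configuration. -/
def QStep {σ : Type*} (Mt : Set (Set (BRule σ))) (W W' : Set σ) : Prop :=
  ∃ m ∈ Mt, W' = applyAppl m W

/-- Head movement directions of an LBA. -/
inductive Dir | L | R | S
deriving DecidableEq

/-- Position update: `L` moves left, `R` moves right, `S` stays. -/
def movePos : Dir → ℕ → ℕ
  | Dir.L, j => j - 1
  | Dir.R, j => j + 1
  | Dir.S, j => j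

/-- A deterministic linear bounded automaton
`𝓜 = (Q, V, T₁, T₂, δ, q₀, q₁, Z_l, B, Z_r)`.  The transition function is
restricted so that the boundary markers are never overwritten or exceeded. -/
structure LBA (Q V : Type*) where
  T1 : Set V
  T2 : Set V
  δ : Q → V → Q × V × Dir
  q0 : Q
  q1 : Q
  Zl : V
  B : V
  Zr : V
  hT1 : Zl ∉ T1 ∧ B ∉ T1 ∧ Zr ∉ T1
  hT2 : Zl ∉ T2 ∧ B ∉ T2 ∧ Zr ∉ T2
  hZl : ∀ q, (δ q Zl).2.1 = Zl ∧ (δ q Zl).2.2 ≠ Dir.L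
  hZr : ∀ q, (δ q Zr).2.1 = Zr ∧ (δ q Zr).2.2 ≠ Dir.R

/-- A configuration of an LBA: the current state, the head position,
and the tape contents. -/
abbrev LBACfg (Q V : Type*) := Q × ℕ × (ℕ → V)

/-- The one-step transition function of an LBA on configurations. -/
def lbaStep {Q V : Type*} (A : LBA Q V) (c : LBACfg Q V) : LBACfg Q V :=
  ((A.δ c.1 (c.2.2 c.2.1)).1,
   movePos (A.δ c.1 (c.2.2 c.2.1)).2.2 c.2.1,
   Function.update c.2.2 c.2.1 (A.δ c.1 (c.2.2 c.2.1)).2.1)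

/-- The symbols of the simulating Boolean P system: `A_{v,j} = inl (v, j)`
encodes that cell `j` contains `v`, and `C_{q,j} = inr (q, j)` encodes that
the head is on cell `j` in state `q`. -/
abbrev LSym (Q V : Type*) := (V × ℕ) ⊕ (Q × ℕ)

/-- The rules `R = ⋃_{ρ∈δ} R_ρ` of the Boolean P system simulating an LBA on
inputs of length `n`: for each instruction `ρ = (q, X; p, Y, D)` and each cell
index `j` in the range determined by `D` (`0 ≤ j ≤ n` for `R`, `0 ≤ j ≤ n+1`
for `S`, `1 ≤ j ≤ n+1` for `L`), the rule
`{A_{X,j}, C_{q,j}} → {A_{Y,j}, C_{p, movePos D j}} | ⊤`. -/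
def lbaRules {Q V : Type*} (A : LBA Q V) (n : ℕ) : Set (BRule (LSym Q V)) :=
  {r | ∃ (q : Q) (X : V) (j : ℕ),
    (match (A.δ q X).2.2 with
     | Dir.R => j ≤ n
     | Dir.S => j ≤ n + 1
     | Dir.L => 1 ≤ j ∧ j ≤ n + 1) ∧
    r = ⟨{Sum.inl (X, j), Sum.inr (q, j)},
         {Sum.inl ((A.δ q X).2.1, j),
          Sum.inr ((A.δ q X).1, movePos (A.δ q X).2.2 j)},
         fun _ => True⟩}

/-- if a configuration `W ⊆ Ṽ` of the Boolean P system simulating a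
deterministic LBA contains exactly one head symbol `C_{q,j}` and, for each cell
index, at most one tape symbol `A_{v,j}`, then at most one rule of `R` is
applicable to `W`. -/
theorem stmt9 {Q V : Type*} [Finite Q] [Finite V]
    (A : LBA Q V) (n : ℕ) (W : Set (LSym Q V))
    (hC : ∃! qj : Q × ℕ, Sum.inr qj ∈ W)
    (hA : ∀ (j : ℕ) (v v' : V),
      Sum.inl (v, j) ∈ W → Sum.inl (v', j) ∈ W → v = v') :
    ∀ r₁ ∈ lbaRules A n, ∀ r₂ ∈ lbaRules A n,
      r₁.applicable W → r₂.applicable W → r₁ = r₂ := by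
  rintro r₁ ⟨q, X, j, -, rfl⟩ r₂ ⟨q', X', j', -, rfl⟩ ⟨h₁, -⟩ ⟨h₂, -⟩
  have e := hC.unique (h₁ (Or.inr rfl)) (h₂ (Or.inr rfl))
  obtain ⟨rfl, rfl⟩ := Prod.mk.inj e
  obtain rfl := hA j X X' (h₁ (Or.inl rfl)) (h₂ (Or.inl rfl))
  rfl
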